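/- Let G = (V, Σ, P) be a context-free grammar and X ∈ V. For every (G,X)-derivation tree t there exists a (G,X)-derivation tree t̃ with π(Y(t̃)) = π(Y(t)) and dim(t̃) ≤ l(t). -/

import Mathlib

/-- A context-free grammar over variables `V` and terminal alphabet `A`:
a set of productions `X → rhs` with `rhs ∈ (A ⊕ V)*`. -/
structure CFG (V : Type) (A : Type) where
  P : Set (V × List (A ⊕ V))

/-- The list of variable occurrences (in order) in a sentential form. -/
def varsOf {V A : Type} (rhs : List (A ⊕ V)) : List V :=
  rhs.filterMap Sum.getRight?

/-- Raw derivation trees: each node is labeled by a variable and a right-hand side,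
and carries the list of subtrees (one per variable occurrence of the rhs). -/
inductive RawTree (V A : Type) : Type where
  | node (X : V) (rhs : List (A ⊕ V)) (children : List (RawTree V A)) : RawTree V A

namespace RawTree

/-- `IsDTree G X t` : `t` is a `(G,X)`-derivation tree. -/
inductive IsDTree {V A : Type} (G : CFG V A) : V → RawTree V A → Prop where
  | node {X : V} {rhs : List (A ⊕ V)} {children : List (RawTree V A)}
      (hP : (X, rhs) ∈ G.P)
      (hch : List.Forall₂ (IsDTree G) (varsOf rhs) children) :
      IsDTree G X (RawTree.node X rhs children)

/-- Helper for `yield`: interleave the terminals of a rhs with the yields of the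
subtrees (consumed in order, one per variable occurrence). -/
def yieldAux {V A : Type} : List (A ⊕ V) → List (List A) → List A
  | [], _ => []
  | (Sum.inl a) :: rest, ys => a :: yieldAux rest ys
  | (Sum.inr _) :: rest, [] => yieldAux rest []
  | (Sum.inr _) :: rest, y :: ys => y ++ yieldAux rest ys

/-- The yield of a derivation tree. -/
def yield {V A : Type} : RawTree V A → List A
  | .node _ rhs cs => yieldAux rhs (cs.attach.map (fun c => yield c.1))
decreasing_by have := List.sizeOf_lt_of_mem c.2; simp; omega

/-- The dimension (Horton–Strahler number) of a tree. -/
def dim {V A : Type} : RawTree V A → ℕ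
  | .node _ _ cs =>
    let ds := cs.attach.map (fun c => dim c.1)
    if ds.isEmpty then 0
    else
      let d := ds.foldr max 0
      if ds.count d = 1 then d else d + 1
decreasing_by have := List.sizeOf_lt_of_mem c.2; simp; omega

/-- The set of variables occurring as left-hand side of a label of some node of `t`. -/
def lhsVars {V A : Type} [DecidableEq V] : RawTree V A → Finset V
  | .node X _ cs => insert X ((cs.attach.map (fun c => lhsVars c.1)).foldr (· ∪ ·) ∅)
decreasing_by have := List.sizeOf_lt_of_mem c.2; simp; omega

/-- `l(t)`: the number of distinct variables labelling (as lhs) the nodes of `t`. -/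
def numLhsVars {V A : Type} [DecidableEq V] (t : RawTree V A) : ℕ := (lhsVars t).card

end RawTree

open RawTree

/-- The Parikh image of a word. -/
noncomputable def parikh {A : Type} (w : List A) : A →₀ ℕ :=
  (w.map (fun a => Finsupp.single a 1)).sum

/-- The ambiguity of `(G,X)` at a word `w`: the number of `(G,X)`-derivation trees
with yield `w`, as an extended natural number. -/
noncomputable def amb {V A : Type} (G : CFG V A) (X : V) (w : List A) : ℕ∞ :=
  Set.encard {t : RawTree V A | IsDTree G X t ∧ yield t = w}

/-- The commutative ambiguity of `(G,X)` at a Parikh vector `v`: the number of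
`(G,X)`-derivation trees whose yield has Parikh image `v`. -/
noncomputable def camb {V A : Type} (G : CFG V A) (X : V) (v : A →₀ ℕ) : ℕ∞ :=
  Set.encard {t : RawTree V A | IsDTree G X t ∧ parikh (yield t) = v}

/-- One rewriting step of `G` on sentential forms. -/
def Produces {V A : Type} (G : CFG V A) (α β : List (A ⊕ V)) : Prop :=
  ∃ pre post X rhs, (X, rhs) ∈ G.P ∧
    α = pre ++ Sum.inr X :: post ∧ β = pre ++ rhs ++ post

/-- Derivation in one or more steps (`⇒⁺`). -/
def DerivesPlus {V A : Type} (G : CFG V A) : List (A ⊕ V) → List (A ⊕ V) → Prop :=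
  Relation.TransGen (Produces G)

/-- Derivation in zero or more steps (`⇒*`). -/
def Derives {V A : Type} (G : CFG V A) : List (A ⊕ V) → List (A ⊕ V) → Prop :=
  Relation.ReflTransGen (Produces G)

/-- A grammar is nonexpansive if no variable `X` derives a sentential form
containing two or more occurrences of `X`. -/
def Nonexpansive {V A : Type} [DecidableEq V] [DecidableEq A] (G : CFG V A) : Prop :=
  ∀ (X : V) (α : List (A ⊕ V)), DerivesPlus G [Sum.inr X] α → α.count (Sum.inr X) ≤ 1

namespace RawTree

variable {V A : Type}

theorem induction_children {p : RawTree V A → Prop}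
    (h : ∀ X rhs cs, (∀ c ∈ cs, p c) → p (node X rhs cs)) : ∀ t, p t
  | .node X rhs cs => h X rhs cs fun c _ => induction_children h c
termination_by t => sizeOf t
decreasing_by
  have := List.sizeOf_lt_of_mem ‹c ∈ cs›
  simp
  omega

/-- The multiset of productions labelling the nodes of a tree. -/
def labels : RawTree V A → Multiset (V × List (A ⊕ V))
  | .node X rhs cs => (X, rhs) ::ₘ (cs.attach.map (fun c => labels c.1)).sum
decreasing_by have := List.sizeOf_lt_of_mem c.2; simp; omega

theorem labels_node (X : V) (rhs : List (A ⊕ V)) (cs : List (RawTree V A)) :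
    labels (node X rhs cs) = (X, rhs) ::ₘ (cs.map labels).sum := by
  rw [labels, List.attach_map_val]

theorem yield_node (X : V) (rhs : List (A ⊕ V)) (cs : List (RawTree V A)) :
    yield (node X rhs cs) = yieldAux rhs (cs.map yield) := by
  rw [yield, List.attach_map_val]

theorem lhsVars_node [DecidableEq V] (X : V) (rhs : List (A ⊕ V)) (cs : List (RawTree V A)) :
    lhsVars (node X rhs cs) = insert X ((cs.map lhsVars).foldr (· ∪ ·) ∅) := by
  rw [lhsVars, List.attach_map_val]

theorem dim_node (X : V) (rhs : List (A ⊕ V)) (cs : List (RawTree V A)) :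
    dim (node X rhs cs) =
      if (cs.map dim).isEmpty then 0
      else if (cs.map dim).count ((cs.map dim).foldr max 0) = 1 then (cs.map dim).foldr max 0
      else (cs.map dim).foldr max 0 + 1 := by
  rw [dim, List.attach_map_val]

theorem mem_foldr_union_map {α β : Type*} [DecidableEq β] (f : α → Finset β) (l : List α)
    (b : β) : b ∈ (l.map f).foldr (· ∪ ·) ∅ ↔ ∃ a ∈ l, b ∈ f a := by
  induction l with
  | nil => simp
  | cons a l ih => simp [ih]

theorem mem_lhsVars_node [DecidableEq V] {X Y : V} {rhs : List (A ⊕ V)}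
    {cs : List (RawTree V A)} :
    Y ∈ lhsVars (node X rhs cs) ↔ Y = X ∨ ∃ c ∈ cs, Y ∈ lhsVars c := by
  rw [lhsVars_node, Finset.mem_insert, mem_foldr_union_map]

theorem mem_sum_map_iff {α β : Type*} (f : α → Multiset β) (l : List α) (b : β) :
    b ∈ (l.map f).sum ↔ ∃ a ∈ l, b ∈ f a := by
  induction l with
  | nil => simp
  | cons a l ih => simp [ih]

theorem lhsVars_eq_toFinset_labels [DecidableEq V] (t : RawTree V A) :
    lhsVars t = ((labels t).map Prod.fst).toFinset := by
  induction t using induction_children with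
  | h X rhs cs ih =>
    ext Y
    rw [mem_lhsVars_node, labels_node]
    simp only [Multiset.map_cons, Multiset.toFinset_cons, Finset.mem_insert,
      Multiset.mem_toFinset, Multiset.mem_map, mem_sum_map_iff]
    refine or_congr_right ⟨?_, ?_⟩
    · rintro ⟨c, hc, hY⟩
      rw [ih c hc] at hY
      simp only [Multiset.mem_toFinset, Multiset.mem_map] at hY
      obtain ⟨l, hl, rfl⟩ := hY
      exact ⟨l, ⟨c, hc, hl⟩, rfl⟩
    · rintro ⟨l, ⟨c, hc, hl⟩, rfl⟩
      refine ⟨c, hc, ?_⟩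
      rw [ih c hc]
      simp only [Multiset.mem_toFinset, Multiset.mem_map]
      exact ⟨l, hl, rfl⟩

theorem foldr_max_le {l : List ℕ} {k : ℕ} (h : ∀ a ∈ l, a ≤ k) : l.foldr max 0 ≤ k := by
  induction l with
  | nil => simp
  | cons b l ih =>
    exact max_le (h b List.mem_cons_self) (ih fun a ha => h a (List.mem_cons_of_mem b ha))

theorem foldr_max_mem {l : List ℕ} (h : l ≠ []) : l.foldr max 0 ∈ l := by
  induction l with
  | nil => simp at h
  | cons b l ih =>
    by_cases hl : l = []
    · simp [hl]
    · have := ih hl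
      grind

theorem dim_node_le_of_count_le_one {X : V} {rhs : List (A ⊕ V)} {cs : List (RawTree V A)}
    {k : ℕ} (hle : ∀ c ∈ cs, dim c ≤ k) (hcount : (cs.map dim).count k ≤ 1) :
    dim (node X rhs cs) ≤ k := by
  rw [dim_node]
  have h1 : (cs.map dim).foldr max 0 ≤ k := foldr_max_le (by simpa using hle)
  split_ifs with h0 h2
  · exact Nat.zero_le _
  · exact h1
  · have hmem := foldr_max_mem (l := cs.map dim) (by simpa using h0)
    rcases h1.lt_or_eq with h | h
    · exact h
    · rw [h] at hmem h2
      have := List.count_pos_iff.2 hmem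
      omega

theorem dim_node_le_of_forall_lt {X : V} {rhs : List (A ⊕ V)} {cs : List (RawTree V A)}
    {k : ℕ} (hle : ∀ c ∈ cs, dim c < k) : dim (node X rhs cs) ≤ k :=
  dim_node_le_of_count_le_one (fun c hc => (hle c hc).le) <| by
    rw [List.count_eq_zero_of_not_mem]
    · exact Nat.zero_le _
    · simp only [List.mem_map, not_exists, not_and]
      exact fun c hc => (hle c hc).ne

/-- `m` is the multiset of labels of some `(G,X)`-derivation tree. -/
def IsTreeLabels (G : CFG V A) (X : V) (m : Multiset (V × List (A ⊕ V))) : Prop :=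
  ∃ t, IsDTree G X t ∧ labels t = m

theorem exists_replace_of_mem {G : CFG V A} {Xs : List V} {cs : List (RawTree V A)}
    (h : List.Forall₂ (IsDTree G) Xs cs) {d : RawTree V A} (hd : d ∈ cs) :
    ∃ Y m, IsDTree G Y d ∧ (cs.map labels).sum = m + labels d ∧
      ∀ k, IsTreeLabels G Y k →
        ∃ cs', List.Forall₂ (IsDTree G) Xs cs' ∧ (cs'.map labels).sum = m + k := by
  induction h with
  | nil => simp at hd
  | @cons X c Xs cs hc hcs ih =>
    rcases List.mem_cons.1 hd with rfl | hd
    · refine ⟨X, (cs.map labels).sum, hc, by simp [add_comm], ?_⟩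
      rintro k ⟨t, ht, rfl⟩
      exact ⟨t :: cs, .cons ht hcs, by simp [add_comm]⟩
    · obtain ⟨Y, m, hY, hm, hrep⟩ := ih hd
      refine ⟨Y, labels c + m, hY, by simp [hm, add_assoc], fun k hk => ?_⟩
      obtain ⟨cs', hcs', hsum⟩ := hrep k hk
      exact ⟨c :: cs', .cons hc hcs', by simp [hsum, add_assoc]⟩

/-- A child of a derivation tree sits in a nonempty context. -/
theorem IsDTree.exists_context_of_mem {G : CFG V A} {X Z : V} {rhs : List (A ⊕ V)}
    {cs : List (RawTree V A)} (h : IsDTree G X (RawTree.node Z rhs cs)) {d : RawTree V A}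
    (hd : d ∈ cs) :
    ∃ Y m, m ≠ 0 ∧ IsDTree G Y d ∧ labels (RawTree.node Z rhs cs) = m + labels d ∧
      ∀ k, IsTreeLabels G Y k → IsTreeLabels G X (m + k) := by
  cases h with
  | node hP hch =>
    obtain ⟨Y, m, hY, hm, hrep⟩ := exists_replace_of_mem hch hd
    refine ⟨Y, (X, rhs) ::ₘ m, Multiset.cons_ne_zero, hY, by simp [labels_node, hm], ?_⟩
    intro k hk
    obtain ⟨cs', hcs', hsum⟩ := hrep k hk
    exact ⟨RawTree.node X rhs cs', .node hP hcs', by simp [labels_node, hsum]⟩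

/-- A tree containing the variable `Y` splits into a context and a `(G,Y)`-subtree. -/
theorem IsDTree.exists_context [DecidableEq V] {G : CFG V A} {X Y : V} {t : RawTree V A}
    (h : IsDTree G X t) (hY : Y ∈ lhsVars t) :
    ∃ m n, IsTreeLabels G Y n ∧ labels t = m + n ∧
      ∀ k, IsTreeLabels G Y k → IsTreeLabels G X (m + k) := by
  induction t using induction_children generalizing X with
  | h Z rhs cs ih =>
    rcases mem_lhsVars_node.1 hY with rfl | ⟨c, hc, hYc⟩
    · have hX : X = Y := by cases h; rfl
      subst hX
      exact ⟨0, _, ⟨_, h, rfl⟩, by simp, by simp⟩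
    · obtain ⟨W, m, -, hW, hm, hctx⟩ := h.exists_context_of_mem hc
      obtain ⟨m', n, hn, hm', hctx'⟩ := ih c hc hW hYc
      refine ⟨m + m', n, hn, by rw [hm, hm', add_assoc], fun k hk => ?_⟩
      rw [add_assoc]
      exact hctx _ (hctx' k hk)

/-- A tree whose dimension is at least its number of variables has a pump `p`, which can be
removed, and inserted at any occurrence of its variable `Y`. -/
theorem IsDTree.exists_pump [DecidableEq V] {G : CFG V A} {X : V} {t : RawTree V A}
    (h : IsDTree G X t) (hdim : numLhsVars t ≤ dim t) :
    ∃ Y ∈ lhsVars t, ∃ m p, p ≠ 0 ∧ labels t = m + p ∧ IsTreeLabels G X m ∧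
      ∀ k, IsTreeLabels G Y k → IsTreeLabels G Y (p + k) := by
  induction t using induction_children generalizing X with
  | h Z rhs cs ih =>
    have hZ : X = Z := by cases h; rfl
    subst hZ
    by_cases hrep : ∃ c ∈ cs, X ∈ lhsVars c
    · obtain ⟨c, hc, hXc⟩ := hrep
      obtain ⟨W, m, hm0, hW, hm, hctx⟩ := h.exists_context_of_mem hc
      obtain ⟨m', n, hn, hm', hctx'⟩ := hW.exists_context hXc
      refine ⟨X, mem_lhsVars_node.2 (.inl rfl), n, m + m', ?_, ?_, hn, fun k hk => ?_⟩
      · simp [hm0]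
      · rw [hm, hm']; abel
      · rw [add_assoc]
        exact hctx _ (hctx' k hk)
    by_cases hbig : ∃ c ∈ cs, numLhsVars c ≤ dim c
    · obtain ⟨c, hc, hcdim⟩ := hbig
      obtain ⟨W, m, -, hW, hm, hctx⟩ := h.exists_context_of_mem hc
      obtain ⟨Y, hY, m', p, hp, hm', hrem, hpump⟩ := ih c hc hW hcdim
      exact ⟨Y, mem_lhsVars_node.2 (.inr ⟨c, hc, hY⟩), m + m', p, hp,
        by rw [hm, hm', add_assoc], hctx _ hrem, hpump⟩
    push Not at hrep hbig
    exfalso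
    have hcard : ∀ c ∈ cs, numLhsVars c < numLhsVars (RawTree.node X rhs cs) := fun c hc =>
      Finset.card_lt_card <| Finset.ssubset_iff_subset_ne.2
        ⟨fun Y hY => mem_lhsVars_node.2 (.inr ⟨c, hc, hY⟩),
          fun he => hrep c hc (he ▸ mem_lhsVars_node.2 (.inl rfl))⟩
    have hpos : 0 < numLhsVars (RawTree.node X rhs cs) :=
      Finset.card_pos.2 ⟨X, mem_lhsVars_node.2 (.inl rfl)⟩
    have : dim (RawTree.node X rhs cs) ≤ numLhsVars (RawTree.node X rhs cs) - 1 :=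
      dim_node_le_of_forall_lt fun c hc => by
        have := hbig c hc
        have := hcard c hc
        omega
    omega

/-- `X`-trees with labels `m` can be rearranged to have dimension at most their number of
variables. -/
def Compactable [DecidableEq V] (G : CFG V A) (X : V) (m : Multiset (V × List (A ⊕ V))) :
    Prop :=
  IsTreeLabels G X m → ∃ t, IsDTree G X t ∧ labels t = m ∧ dim t ≤ numLhsVars t

/-- If all trees of size at most `n` can be rearranged to have small dimension, then any
forest of size at most `n` can be rearranged so that, moreover, at most one of its trees attains
the number of available variables as its dimension. -/
theorem exists_compact_forest [DecidableEq V] {G : CFG V A} {n : ℕ}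
    (hn : ∀ X m, m.card ≤ n → Compactable G X m) (S : Finset V) (Xs : List V)
    (cs : List (RawTree V A)) (hcs : List.Forall₂ (IsDTree G) Xs cs)
    (hcard : (cs.map labels).sum.card ≤ n)
    (hS : ∀ l ∈ (cs.map labels).sum, l.1 ∈ S) :
    ∃ cs', List.Forall₂ (IsDTree G) Xs cs' ∧ (cs'.map labels).sum = (cs.map labels).sum ∧
      (∀ c ∈ cs', dim c ≤ numLhsVars c) ∧ (cs'.map dim).count S.card ≤ 1 := by
  induction Xs generalizing cs with
  | nil =>
    cases hcs
    exact ⟨[], .nil, rfl, by simp, by simp⟩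
  | cons X Xs ih =>
    obtain ⟨c, cs, hc, hcs', rfl⟩ := List.forall₂_cons_left_iff.1 hcs
    clear hcs
    induction hN : (labels c).card using Nat.strong_induction_on generalizing c cs with
    | _ N ihN =>
    simp only [List.map_cons, List.sum_cons, Multiset.card_add, Multiset.mem_add] at hcard hS
    obtain ⟨c₁, hc₁, hlc, hdc⟩ := hn X (labels c) (by omega) ⟨c, hc, rfl⟩
    obtain ⟨cs₁, hcs₁, hlcs, hdcs, hcount⟩ :=
      ih cs hcs' (by omega) (fun l hl => hS l (.inr hl))
    by_cases hdone : dim c₁ = S.card ∧ S.card ∈ cs₁.map dim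
    · obtain ⟨hdim, hmem⟩ := hdone
      obtain ⟨d, hd, hdd⟩ := List.mem_map.1 hmem
      have hsub : ∀ {t : RawTree V A}, (∀ l ∈ labels t, l.1 ∈ S) → lhsVars t ⊆ S := by
        intro t ht Y hY
        rw [lhsVars_eq_toFinset_labels, Multiset.mem_toFinset, Multiset.mem_map] at hY
        obtain ⟨l, hl, rfl⟩ := hY
        exact ht l hl
      have hcS : lhsVars c₁ ⊆ S := hsub fun l hl => hS l (.inl (hlc ▸ hl))
      have hdS : lhsVars d ⊆ S := hsub fun l hl =>
        hS l (.inr (hlcs ▸ (mem_sum_map_iff _ _ _).2 ⟨d, hd, hl⟩))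
      have hdS' : lhsVars d = S := Finset.eq_of_subset_of_card_le hdS (hdd ▸ hdcs d hd)
      obtain ⟨Y, hY, m, p, hp, hm, ⟨c₂, hc₂, hlc₂⟩, hpump⟩ :=
        hc₁.exists_pump (hdim ▸ Finset.card_le_card hcS)
      obtain ⟨Z, r, hZ, hr, hrep⟩ := exists_replace_of_mem hcs₁ hd
      obtain ⟨a, b, hb, hab, hctx⟩ := hZ.exists_context (Y := Y) (hdS' ▸ hcS hY)
      obtain ⟨cs₂, hcs₂, hlcs₂⟩ := hrep _ (hctx _ (hpump b hb))
      have htot : ((c₂ :: cs₂).map labels).sum = ((c :: cs).map labels).sum := by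
        simp only [List.map_cons, List.sum_cons]
        rw [hlc₂, hlcs₂, ← hlcs, ← hlc, hm, hr, hab]
        abel
      have hlt : (labels c₂).card < N := by
        have := Multiset.card_pos.2 hp
        rw [← hN, ← hlc, hm, hlc₂, Multiset.card_add]
        omega
      rw [← htot]
      refine ihN _ hlt c₂ cs₂ hc₂ hcs₂ ?_ ?_ rfl
      · rw [htot]; simpa using hcard
      · rw [htot]; simpa using hS
    · refine ⟨c₁ :: cs₁, .cons hc₁ hcs₁, by simp [hlc, hlcs], ?_, ?_⟩
      · simpa using ⟨hdc, hdcs⟩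
      · rw [List.map_cons, List.count_cons]
        by_cases hdim : dim c₁ = S.card
        · have : (cs₁.map dim).count S.card = 0 :=
            List.count_eq_zero_of_not_mem fun hmem => hdone ⟨hdim, hmem⟩
          simp [this, hdim]
        · simpa [hdim] using hcount

theorem compactable [DecidableEq V] (G : CFG V A) (X : V) (m : Multiset (V × List (A ⊕ V))) :
    Compactable G X m := by
  induction hN : m.card using Nat.strong_induction_on generalizing X m with
  | _ N ih =>
  rintro ⟨t, ht, rfl⟩
  obtain ⟨hP, hch⟩ := ht
  rename_i rhs cs
  rw [labels_node, Multiset.card_cons] at hN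
  have hvars : ∀ l ∈ (cs.map labels).sum, l.1 ∈ lhsVars (node X rhs cs) := fun l hl => by
    rw [lhsVars_eq_toFinset_labels, labels_node, Multiset.mem_toFinset]
    exact Multiset.mem_map_of_mem _ (Multiset.mem_cons_of_mem hl)
  obtain ⟨cs', hcs', hsum, hdim, hcount⟩ := exists_compact_forest
    (fun Y k hk => ih k.card (by omega) Y k rfl) (lhsVars (node X rhs cs)) _ cs hch le_rfl hvars
  have hlabels : labels (node X rhs cs') = labels (node X rhs cs) := by
    rw [labels_node, labels_node, hsum]
  have hlhs : lhsVars (node X rhs cs') = lhsVars (node X rhs cs) := by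
    rw [lhsVars_eq_toFinset_labels, lhsVars_eq_toFinset_labels, hlabels]
  refine ⟨node X rhs cs', .node hP hcs', hlabels, dim_node_le_of_count_le_one ?_ ?_⟩
  · exact fun c hc => (hdim c hc).trans <| Finset.card_le_card fun Y hY =>
      mem_lhsVars_node.2 (.inr ⟨c, hc, hY⟩)
  · rwa [numLhsVars, hlhs]

theorem parikh_append (u v : List A) : parikh (u ++ v) = parikh u + parikh v := by
  simp [parikh]

theorem parikh_yieldAux (rhs : List (A ⊕ V)) (ys : List (List A))
    (h : (varsOf rhs).length = ys.length) :
    parikh (yieldAux rhs ys) =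
      parikh (rhs.filterMap Sum.getLeft?) + (ys.map parikh).sum := by
  induction rhs generalizing ys with
  | nil =>
    obtain rfl : ys = [] := by simpa [varsOf, eq_comm] using h
    simp [yieldAux]
  | cons s rhs ih =>
    rcases s with a | Z
    · have := ih ys (by simpa [varsOf, List.filterMap_cons] using h)
      simp only [parikh] at this
      simp [yieldAux, parikh, this, add_assoc]
    · cases ys with
      | nil => simp [varsOf] at h
      | cons y ys =>
        have := ih ys (by simpa [varsOf] using h)
        simp [yieldAux, parikh_append, this, add_left_comm, List.filterMap_cons]

/-- The Parikh image of the yield depends only on the labels of a derivation tree. -/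
theorem IsDTree.parikh_yield {G : CFG V A} {X : V} {t : RawTree V A} (h : IsDTree G X t) :
    parikh (yield t) =
      ((labels t).map fun l => parikh (l.2.filterMap Sum.getLeft?)).sum := by
  induction t using induction_children generalizing X with
  | h Z rhs cs ih =>
    cases h with
    | node hP hch =>
      rw [yield_node, parikh_yieldAux _ _ (by simpa using hch.length_eq), labels_node,
        Multiset.map_cons, Multiset.sum_cons]
      congr 1
      clear hP
      generalize varsOf rhs = Xs at hch
      induction hch with
      | nil => simp
      | cons hc hcs ihcs =>
        simp only [List.map_cons, List.sum_cons, Multiset.map_add, Multiset.sum_add]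
        rw [ih _ List.mem_cons_self hc, ihcs fun c hc => ih c (List.mem_cons_of_mem _ hc)]

end RawTree

/-- For every `(G,X)`-derivation tree `t` there is a Parikh-equivalent
`(G,X)`-derivation tree of dimension at most `l(t)`. -/
theorem exists_parikh_equiv_small_dim {V A : Type} [Fintype V] [Fintype A]
    [DecidableEq V] (G : CFG V A) (hGfin : G.P.Finite)
    (X : V) (t : RawTree V A) (ht : IsDTree G X t) :
    ∃ t' : RawTree V A, IsDTree G X t' ∧ parikh (yield t') = parikh (yield t) ∧
      dim t' ≤ numLhsVars t := by
  obtain ⟨t', ht', hlabels, hdim⟩ := compactable G X _ ⟨t, ht, rfl⟩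
  refine ⟨t', ht', by rw [ht'.parikh_yield, ht.parikh_yield, hlabels], ?_⟩
  rwa [numLhsVars, lhsVars_eq_toFinset_labels, hlabels, ← lhsVars_eq_toFinset_labels] at hdim
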